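/- arXiv:2502.19967 — 2 statements merged into one kernel-verified Lean document; each statement's English description precedes it below -/
import Mathlib

section
/- Under the merge scenario described in the context (D satisfying rc-non-comm, cond-comm and no-rc-chain, a reachable configuration C and a Merge transition C → C' with event sets L⊤ᵃ, L⊤ᵇ and relation lo_m): for every event e ∈ L⊤ᵃ and every event e' ∈ L⊤ᵇ, it is not the case that e →lo_m e'. -/
/-- An MRDT implementation `D = (Σ, σ₀, do, merge, rc)`. -/
structure MRDT (T R O : Type) where
  State : Type
  init : State
  doOp : State → T → R → O → State
  merge : State → State → State → State
  rc : O → O → Prop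

/-- An event is a triple `(t, r, o)`. -/
abbrev Event (T R O : Type) := T × R × O

variable {T R O : Type}

/-- Applying an event to a state: `e(σ) = do σ t r o`. -/
def MRDT.applyEvent (D : MRDT T R O) (e : Event T R O) (σ : D.State) : D.State :=
  D.doOp σ e.1 e.2.1 e.2.2

/-- Applying a finite sequence of events to a state. -/
def MRDT.applySeq (D : MRDT T R O) (π : List (Event T R O)) (σ : D.State) : D.State :=
  π.foldl (fun s e => D.applyEvent e s) σ

/-- A configuration `C = (N, H, L, G, vis)`; versions are natural numbers. -/
structure Config (T R O S : Type) where
  N : ℕ → Option S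
  H : R → Option ℕ
  L : ℕ → Finset (Event T R O)
  E : ℕ → ℕ → Prop
  vis : Event T R O → Event T R O → Prop

/-- `E_C`: the set of events appearing at some version of `C`. -/
def Config.events {S : Type} (C : Config T R O S) : Set (Event T R O) :=
  {e | ∃ v, (C.N v).isSome ∧ e ∈ C.L v}

/-- `vt` is a lowest common ancestor of `v1` and `v2` in the graph with
vertex set `V` and edge relation `E`. -/
def isLCA (V : ℕ → Prop) (E : ℕ → ℕ → Prop) (v1 v2 vt : ℕ) : Prop :=
  V vt ∧ Relation.ReflTransGen E vt v1 ∧ Relation.ReflTransGen E vt v2 ∧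
    ∀ v, V v → Relation.ReflTransGen E v v1 → Relation.ReflTransGen E v v2 →
      Relation.ReflTransGen E v vt

variable [DecidableEq T] [DecidableEq R] [DecidableEq O]

/-- Result of a `CreateBranch` transition. -/
def branchConfig (D : MRDT T R O) (C : Config T R O D.State)
    (r' : R) (vr v : ℕ) (σ : D.State) : Config T R O D.State where
  N := Function.update C.N v (some σ)
  H := Function.update C.H r' (some v)
  L := Function.update C.L v (C.L vr)
  E := fun u w => C.E u w ∨ (u = vr ∧ w = v)
  vis := C.vis

/-- Result of an `Apply` transition. -/
def applyConfig (D : MRDT T R O) (C : Config T R O D.State)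
    (t : T) (r : R) (o : O) (vr v : ℕ) (σ : D.State) : Config T R O D.State where
  N := Function.update C.N v (some (D.applyEvent (t, r, o) σ))
  H := Function.update C.H r (some v)
  L := Function.update C.L v (insert (t, r, o) (C.L vr))
  E := fun u w => C.E u w ∨ (u = vr ∧ w = v)
  vis := fun e1 e2 => C.vis e1 e2 ∨ (e1 ∈ C.L vr ∧ e2 = (t, r, o))

/-- Result of a `Merge` transition. -/
def mergeConfig (D : MRDT T R O) (C : Config T R O D.State)
    (r1 : R) (v1 v2 vt v : ℕ) (σt σ1 σ2 : D.State) : Config T R O D.State where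
  N := Function.update C.N v (some (D.merge σt σ1 σ2))
  H := Function.update C.H r1 (some v)
  L := Function.update C.L v (C.L v1 ∪ C.L v2)
  E := fun u w => C.E u w ∨ ((u = v1 ∨ u = v2) ∧ w = v)
  vis := C.vis

/-- The transition relation of the replicated datastore. -/
inductive Step (D : MRDT T R O) : Config T R O D.State → Config T R O D.State → Prop
  | createBranch (C : Config T R O D.State) (r r' : R) (vr v : ℕ) (σ : D.State)
      (hr : C.H r = some vr) (hσ : C.N vr = some σ)
      (hr' : C.H r' = none) (hv : C.N v = none) :
      Step D C (branchConfig D C r' vr v σ)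
  | applyOp (C : Config T R O D.State) (t : T) (r : R) (o : O) (vr v : ℕ) (σ : D.State)
      (hr : C.H r = some vr) (hσ : C.N vr = some σ) (hv : C.N v = none)
      (ht : ∀ e' ∈ C.events, e'.1 ≠ t) :
      Step D C (applyConfig D C t r o vr v σ)
  | mergeOp (C : Config T R O D.State) (r1 r2 : R) (v1 v2 vt v : ℕ) (σ1 σ2 σt : D.State)
      (h1 : C.H r1 = some v1) (h2 : C.H r2 = some v2)
      (hσ1 : C.N v1 = some σ1) (hσ2 : C.N v2 = some σ2) (hσt : C.N vt = some σt)
      (hlca : isLCA (fun u => (C.N u).isSome) C.E v1 v2 vt)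
      (hv : C.N v = none) :
      Step D C (mergeConfig D C r1 v1 v2 vt v σt σ1 σ2)
  | queryOp (C : Config T R O D.State) : Step D C C

/-- The initial configuration, with a single replica `r0` and head version `0`. -/
def initConfig (D : MRDT T R O) (r0 : R) : Config T R O D.State where
  N := fun u => if u = 0 then some D.init else none
  H := fun r => if r = r0 then some 0 else none
  L := fun _ => ∅
  E := fun _ _ => False
  vis := fun _ _ => False

/-- A configuration is reachable if obtained from the initial configuration
by a finite sequence of transitions. -/
def Reachable (D : MRDT T R O) (C : Config T R O D.State) : Prop :=
  ∃ r0 : R, Relation.ReflTransGen (Step D) (initConfig D r0) C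

/-- Events `e, e'` commute: `e(e'(σ)) = e'(e(σ))` for all states. -/
def MRDT.Commute (D : MRDT T R O) (e e' : Event T R O) : Prop :=
  ∀ σ : D.State, D.applyEvent e (D.applyEvent e' σ) = D.applyEvent e' (D.applyEvent e σ)

/-- The linearization relation `lo_C` on `E_C`. -/
def lo (D : MRDT T R O) (C : Config T R O D.State) (e1 e2 : Event T R O) : Prop :=
  e1 ∈ C.events ∧ e2 ∈ C.events ∧
    ((C.vis e1 e2 ∧ ¬ D.Commute e1 e2) ∨
     (¬ C.vis e1 e2 ∧ ¬ C.vis e2 e1 ∧ D.rc e1.2.2 e2.2.2 ∧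
       ¬ ∃ e3, e3 ∈ C.events ∧ C.vis e2 e3 ∧ ¬ D.Commute e2 e3))

/-- `e` occurs strictly before `e'` in the list `π`. -/
def precedes (π : List (Event T R O)) (e e' : Event T R O) : Prop :=
  ∃ i j : ℕ, i < j ∧ π[i]? = some e ∧ π[j]? = some e'

/-- A configuration is RA-linearizable. -/
def RALinConfig (D : MRDT T R O) (C : Config T R O D.State) : Prop :=
  ∀ r vr, C.H r = some vr →
    ∃ π : List (Event T R O), π.Nodup ∧ (∀ e, e ∈ π ↔ e ∈ C.L vr) ∧
      (∀ e e', e ∈ C.L vr → e' ∈ C.L vr → lo D C e e' → precedes π e e') ∧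
      C.N vr = some (D.applySeq π D.init)

/-- `rc-non-comm`. -/
def RcNonComm (D : MRDT T R O) : Prop :=
  ∀ o1 o2 : O,
    (∃ e1 e2 : Event T R O, e1.2.2 = o1 ∧ e2.2.2 = o2 ∧ ¬ D.Commute e1 e2) ↔
      (D.rc o1 o2 ∨ D.rc o2 o1)

/-- `cond-comm`. -/
def CondComm (D : MRDT T R O) : Prop :=
  ∀ o1 o2 o3 : O, D.rc o1 o2 →
    (∃ e2 e3 : Event T R O, e2.2.2 = o2 ∧ e3.2.2 = o3 ∧ ¬ D.Commute e2 e3) →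
    ∀ e1 e2 e3 : Event T R O, e1.2.2 = o1 → e2.2.2 = o2 → e3.2.2 = o3 →
      ∀ (σ : D.State) (π : List (Event T R O)),
        D.applyEvent e3 (D.applySeq π (D.applyEvent e1 (D.applyEvent e2 σ))) =
          D.applyEvent e3 (D.applySeq π (D.applyEvent e2 (D.applyEvent e1 σ)))

/-- `no-rc-chain`. -/
def NoRcChain (D : MRDT T R O) : Prop :=
  ¬ ∃ o1 o2 o3 : O, D.rc o1 o2 ∧ D.rc o2 o3

/-- A list of events has pairwise distinct timestamps. -/
def Distinct (l : List (Event T R O)) : Prop :=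
  l.Pairwise (fun e e' => e.1 ≠ e'.1)

/-- Visibility targets recorded events, and every version's event set is closed under
visibility predecessors. -/
def Config.VisClosed {S : Type} (C : Config T R O S) : Prop :=
  (∀ a b, C.vis a b → b ∈ C.events) ∧
    ∀ u, (C.N u).isSome → ∀ a b, C.vis a b → b ∈ C.L u → a ∈ C.L u

/-- Adding a fresh version whose event set is vis-closed preserves `Config.VisClosed`. -/
theorem Config.VisClosed.update {S : Type} {C C' : Config T R O S} (h : C.VisClosed)
    {w : ℕ} {s : S} {l : Finset (Event T R O)} (hw : C.N w = none)
    (hN : C'.N = Function.update C.N w (some s)) (hL : C'.L = Function.update C.L w l)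
    (hvis : ∀ a b, C'.vis a b → C.vis a b ∨ (b ∈ l ∧ b ∉ C.events))
    (hl : ∀ a b, C'.vis a b → b ∈ l → a ∈ l) : C'.VisClosed := by
  have hold : ∀ u, (C.N u).isSome → u ≠ w := by
    rintro u hu rfl
    simp [hw] at hu
  refine ⟨fun a b hab => ?_, fun u hu a b hab hb => ?_⟩
  · rcases hvis a b hab with hab | ⟨hb, -⟩
    · obtain ⟨u, hu, hb⟩ := h.1 a b hab
      exact ⟨u, by simpa [hN, hold u hu] using hu, by simpa [hL, hold u hu] using hb⟩
    · exact ⟨w, by simp [hN], by simpa [hL] using hb⟩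
  · by_cases huw : u = w
    · subst huw
      simp only [hL, Function.update_self] at hb ⊢
      exact hl a b hab hb
    · simp only [hN, hL, Function.update_of_ne huw] at hu hb ⊢
      rcases hvis a b hab with hab | ⟨-, hne⟩
      · exact h.2 u hu a b hab hb
      · exact absurd ⟨u, hu, hb⟩ hne

theorem Step.visClosed {D : MRDT T R O} {C C' : Config T R O D.State}
    (hs : Step D C C') (h : C.VisClosed) : C'.VisClosed := by
  cases hs with
  | createBranch r r' vr w σ hr hσ hr' hw =>
    exact h.update hw rfl rfl (fun _ _ => Or.inl) (h.2 vr (by simp [hσ]))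
  | applyOp t r o vr w σ hr hσ hw ht =>
    have hnew : (t, r, o) ∉ C.events := fun he => ht _ he rfl
    have hvr : (C.N vr).isSome := by simp [hσ]
    refine h.update hw rfl rfl ?_ ?_
    · rintro a b (hab | ⟨-, rfl⟩)
      · exact Or.inl hab
      · exact Or.inr ⟨Finset.mem_insert_self _ _, hnew⟩
    · rintro a b (hab | ⟨ha, -⟩) hb
      · rcases Finset.mem_insert.mp hb with rfl | hb
        · exact absurd (h.1 _ _ hab) hnew
        · exact Finset.mem_insert_of_mem (h.2 vr hvr a b hab hb)
      · exact Finset.mem_insert_of_mem ha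
  | mergeOp r1 r2 v1 v2 vt w σ1 σ2 σt h1 h2 hσ1 hσ2 hσt hlca hw =>
    refine h.update hw rfl rfl (fun _ _ => Or.inl) fun a b hab hb => ?_
    rcases Finset.mem_union.mp hb with hb | hb
    · exact Finset.mem_union_left _ (h.2 v1 (by simp [hσ1]) a b hab hb)
    · exact Finset.mem_union_right _ (h.2 v2 (by simp [hσ2]) a b hab hb)
  | queryOp => exact h

theorem Reachable.visClosed {D : MRDT T R O} {C : Config T R O D.State}
    (hC : Reachable D C) : C.VisClosed := by
  obtain ⟨r0, hC⟩ := hC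
  induction hC with
  | refl => exact ⟨fun _ _ => False.elim, fun _ _ _ _ => False.elim⟩
  | tail _ hs ih => exact hs.visClosed ih

/-- in the merge scenario, no event of `L⊤ᵃ` is `lo_m`-before an
event of `L⊤ᵇ`. -/
theorem no_lom_LtA_to_LtB (T R O : Type) [DecidableEq T] [DecidableEq R] [DecidableEq O]
    (D : MRDT T R O)
    (hnc : RcNonComm D) (hcc : CondComm D) (hchain : NoRcChain D)
    (C : Config T R O D.State) (hC : Reachable D C)
    (r1 r2 : R) (v1 v2 vt v : ℕ) (σ1 σ2 σt : D.State)
    (h1 : C.H r1 = some v1) (h2 : C.H r2 = some v2)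
    (hσ1 : C.N v1 = some σ1) (hσ2 : C.N v2 = some σ2) (hσt : C.N vt = some σt)
    (hlca : isLCA (fun u => (C.N u).isSome) C.E v1 v2 vt)
    (hv : C.N v = none)
    (C' : Config T R O D.State)
    (hC' : C' = mergeConfig D C r1 v1 v2 vt v σt σ1 σ2)
    (L1 L2 Lt : Finset (Event T R O))
    (hL1 : L1 = C.L v1) (hL2 : L2 = C.L v2) (hLt : Lt = C.L vt)
    (lom : Event T R O → Event T R O → Prop)
    (hlom : lom = fun e1 e2 => lo D C' e1 e2 ∧ e1 ∈ L1 ∪ L2 ∧ e2 ∈ L1 ∪ L2)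
    (L1' L2' : Finset (Event T R O))
    (hL1' : L1' = L1 \ Lt) (hL2' : L2' = L2 \ Lt)
    (L1b L2b : Set (Event T R O))
    (hL1b : L1b = {e | e ∈ L1' ∧ ∃ et ∈ Lt,
      (lom e et ∨ ∃ e' ∈ L1', lom e e' ∧ lom e' et)})
    (hL2b : L2b = {e | e ∈ L2' ∧ ∃ et ∈ Lt,
      (lom e et ∨ ∃ e' ∈ L2', lom e e' ∧ lom e' et)})
    (LtA : Set (Event T R O))
    (hLtA : LtA = {et | et ∈ Lt ∧ ∃ e ∈ L1b ∪ L2b, lom e et})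
    (L1a L2a LtB : Set (Event T R O))
    (hL1a : L1a = {e | e ∈ L1' ∧ e ∉ L1b})
    (hL2a : L2a = {e | e ∈ L2' ∧ e ∉ L2b})
    (hLtB : LtB = {et | et ∈ Lt ∧ et ∉ LtA})
    : ∀ e ∈ LtA, ∀ e' ∈ LtB, ¬ lom e e' := by
  subst hC' hlom hLtA hLtB hLt
  rintro e ⟨het, e₀, he₀, ⟨-, -, hlo₀⟩, -⟩ e' - ⟨⟨-, he', hlo⟩, -⟩
  have he₀t : e₀ ∉ C.L vt := by
    subst hL1b hL2b hL1' hL2'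
    rcases he₀ with he₀ | he₀ <;> exact (Finset.mem_sdiff.mp he₀.1).2
  rcases hlo₀ with ⟨hvis, -⟩ | ⟨-, -, hrc, hlast⟩
  · exact he₀t (hC.visClosed.2 vt (by simp [hσt]) e₀ e hvis het)
  · rcases hlo with ⟨hvis, hcomm⟩ | ⟨-, -, hrc', -⟩
    · exact hlast ⟨e', he', hvis, hcomm⟩
    · exact hchain ⟨_, _, _, hrc, hrc'⟩
end

section
/- If an MRDT implementation D satisfies rc-non-comm, cond-comm, no-rc-chain, BottomUp-2-OP, BottomUp-1-OP, BottomUp-0-OP, MergeIdempotence and MergeCommutativity, then D is RA-linearizable, i.e. every reachable configuration of its transition system is RA-linearizable. -/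
variable {T R O : Type}

variable [DecidableEq T] [DecidableEq R] [DecidableEq O]

/-- The `BottomUp-2-OP` property. -/
def BottomUp2OP (D : MRDT T R O) : Prop :=
  ∀ e1 e2 : Event T R O, e1.1 ≠ e2.1 →
    (D.rc e1.2.2 e2.2.2 ∨ D.Commute e1 e2) →
    ∀ l a b : D.State,
      D.merge l (D.applyEvent e1 a) (D.applyEvent e2 b) =
        D.applyEvent e2 (D.merge l (D.applyEvent e1 a) b)

/-- The `BottomUp-1-OP` property. -/
def BottomUp1OP (D : MRDT T R O) : Prop :=
  (∀ et e1 : Event T R O, e1.1 ≠ et.1 →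
    ∀ l a b : D.State,
      D.merge (D.applyEvent et l) (D.applyEvent e1 a) (D.applyEvent et b) =
        D.applyEvent e1 (D.merge (D.applyEvent et l) a (D.applyEvent et b))) ∧
  (∀ e1 : Event T R O, ∀ l a : D.State,
    D.merge l (D.applyEvent e1 a) l = D.applyEvent e1 (D.merge l a l))

/-- The `BottomUp-0-OP` property. -/
def BottomUp0OP (D : MRDT T R O) : Prop :=
  ∀ et : Event T R O, ∀ l a b : D.State,
    D.merge (D.applyEvent et l) (D.applyEvent et a) (D.applyEvent et b) =
      D.applyEvent et (D.merge l a b)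

/-- `MergeIdempotence`. -/
def MergeIdempotence (D : MRDT T R O) : Prop :=
  ∀ a : D.State, D.merge a a a = a

/-- `MergeCommutativity`. -/
def MergeCommutativity (D : MRDT T R O) : Prop :=
  ∀ l a b : D.State, D.merge l a b = D.merge l b a

/-- Abstract core of the commutation argument: two unary operations `e`, `x` on a type with a
ternary merge commute as soon as they satisfy the bottom-up rules for `rc e x`. -/
theorem commute_of_bottomUp_rules {S : Type} (e x : S → S) (m : S → S → S → S)
    (idem : ∀ a, m a a a = a) (comm : ∀ l a b, m l a b = m l b a)
    (two : ∀ l a b, m l (e a) (x b) = x (m l (e a) b))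
    (one : ∀ l a b, m (x l) (e a) (x b) = e (m (x l) a (x b)))
    (one' : ∀ l a b, m (e l) (x a) (e b) = x (m (e l) a (e b)))
    (same_e : ∀ l a, m l (e a) l = e (m l a l)) (same_x : ∀ l a, m l (x a) l = x (m l a l))
    (zero_e : ∀ l a b, m (e l) (e a) (e b) = e (m l a b))
    (zero_x : ∀ l a b, m (x l) (x a) (x b) = x (m l a b))
    (cond : ∀ s, e (e (x s)) = e (x (e s))) (s : S) : e (x s) = x (e s) := by
  have hexx : e (x (x s)) = x (e (x s)) := by
    calc e (x (x s)) = e (x (m s s (x s))) := by rw [comm, same_x, idem]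
      _ = m (x s) (e (x s)) (x (x s)) := by rw [one, zero_x]
      _ = x (e (x s)) := by rw [two, same_e, idem]
  have hxe : x (e (m (x s) (x s) s)) = x (e s) := by
    rw [comm, ← one s s s, ← same_x, zero_x, same_e, idem]
  generalize hy : e (x s) = y at hexx
  have hu : e (x (m y y s)) = y := by
    calc e (x (m y y s)) = e (m y (x s) y) := by rw [comm y y s, ← hy, one']
      _ = y := by rw [← same_e, hy, idem]
  have hp : e (x (m y s (x s))) = x (m y y s) := by
    rw [comm y s, ← zero_x, ← one, hexx, zero_x]
  symm
  calc x (e s) = x (m y y (e s)) := by rw [← hxe, ← hy, zero_e]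
    _ = m (x y) (e (x (x s))) (x (e s)) := by rw [hexx, zero_x]
    _ = m (x y) (e (x (e s))) (x (x s)) := by rw [one, comm, ← one]
    _ = m (x y) (e (e (x s))) (x (x s)) := by rw [cond]
    _ = e (e (x (m y s (x s)))) := by rw [one, one, zero_x]
    _ = y := by rw [hp, hu]

theorem MRDT.Commute.symm {D : MRDT T R O} {e e' : Event T R O} (h : D.Commute e e') :
    D.Commute e' e :=
  fun σ => (h σ).symm

/-- Under the bottom-up properties, events with distinct timestamps commute. -/
theorem commute_of_time_ne {D : MRDT T R O} (hnc : RcNonComm D) (hcc : CondComm D)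
    (h2 : BottomUp2OP D) (h1 : BottomUp1OP D) (h0 : BottomUp0OP D)
    (hidem : MergeIdempotence D) (hcomm : MergeCommutativity D)
    {e x : Event T R O} (hne : e.1 ≠ x.1) : D.Commute e x := by
  have key : ∀ e x : Event T R O, e.1 ≠ x.1 → D.rc e.2.2 x.2.2 → D.Commute e x := by
    intro e x hne hrc σ
    refine commute_of_bottomUp_rules (D.applyEvent e) (D.applyEvent x) D.merge hidem hcomm
      (h2 e x hne (Or.inl hrc)) (h1.1 x e hne) (h1.1 e x hne.symm) (h1.2 e) (h1.2 x)
      (h0 e) (h0 x) (fun s => ?_) σ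
    exact hcc _ _ e.2.2 hrc ((hnc _ _).2 (Or.inr hrc)) e x e rfl rfl rfl s []
  by_contra hcon
  rcases (hnc e.2.2 x.2.2).1 ⟨e, x, rfl, rfl, hcon⟩ with h | h
  · exact hcon (key e x hne h)
  · exact hcon (key x e hne.symm h).symm

theorem MRDT.applySeq_append (D : MRDT T R O) (π ρ : List (Event T R O)) (σ : D.State) :
    D.applySeq (π ++ ρ) σ = D.applySeq ρ (D.applySeq π σ) :=
  List.foldl_append

theorem MRDT.applySeq_perm {D : MRDT T R O} {π ρ : List (Event T R O)} (h : π.Perm ρ)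
    (hc : ∀ e ∈ π, ∀ e' ∈ π, D.Commute e e') (σ : D.State) :
    D.applySeq π σ = D.applySeq ρ σ :=
  h.foldl_eq' (fun e he e' he' s => (hc e he e' he' s).symm) σ

theorem merge_applySeq_same {D : MRDT T R O} (h0 : BottomUp0OP D) (π : List (Event T R O))
    (l a b : D.State) :
    D.merge (D.applySeq π l) (D.applySeq π a) (D.applySeq π b) = D.applySeq π (D.merge l a b) := by
  induction π generalizing l a b with
  | nil => rfl
  | cons e π ih =>
    change D.merge (D.applySeq π _) (D.applySeq π _) (D.applySeq π _) = D.applySeq π _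
    rw [ih, h0]

theorem merge_applySeq_left {D : MRDT T R O} (h1 : BottomUp1OP D) (hidem : MergeIdempotence D)
    (α : List (Event T R O)) (σ : D.State) : D.merge σ (D.applySeq α σ) σ = D.applySeq α σ := by
  induction α using List.reverseRecOn with
  | nil => exact hidem σ
  | append_singleton α e ih =>
    rw [D.applySeq_append]
    change D.merge σ (D.applyEvent e _) σ = D.applyEvent e _
    rw [h1.2, ih]

/-- Merging two sequences of updates that start from the common ancestor replays both. -/
theorem merge_applySeq {D : MRDT T R O} (h2 : BottomUp2OP D) (h1 : BottomUp1OP D)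
    (hidem : MergeIdempotence D) (hcomm : MergeCommutativity D) (α β : List (Event T R O))
    (hne : ∀ e ∈ α, ∀ e' ∈ β, e.1 ≠ e'.1) (hc : ∀ e ∈ α, ∀ e' ∈ β, D.Commute e e')
    (σ : D.State) :
    D.merge σ (D.applySeq α σ) (D.applySeq β σ) = D.applySeq (α ++ β) σ := by
  rcases List.eq_nil_or_concat' α with rfl | ⟨α, e, rfl⟩
  · change D.merge σ σ (D.applySeq β σ) = D.applySeq β σ
    rw [hcomm, merge_applySeq_left h1 hidem]
  induction β using List.reverseRecOn with
  | nil =>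
    rw [List.append_nil]
    exact merge_applySeq_left h1 hidem _ _
  | append_singleton β e' ih =>
    have he : e ∈ α ++ [e] := by simp
    have he' : e' ∈ β ++ [e'] := by simp
    have ih' := ih (fun a ha b hb => hne a ha b (List.mem_append_left _ hb))
      (fun a ha b hb => hc a ha b (List.mem_append_left _ hb))
    rw [← List.append_assoc, D.applySeq_append β, D.applySeq_append (_ ++ β), ← ih',
      D.applySeq_append α]
    exact h2 e e' (hne e he e' he') (Or.inr (hc e he e' he')) _ _ _

/-- Invariant of reachable configurations: every version stores the replay of its event set,
timestamps identify events, event sets grow along edges, and every event originates at a version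
from which all versions containing it descend. -/
structure Config.Coherent (D : MRDT T R O) (C : Config T R O D.State) : Prop where
  state : ∀ v σ, C.N v = some σ → σ = D.applySeq (C.L v).toList D.init
  time : ∀ e ∈ C.events, ∀ e' ∈ C.events, e.1 = e'.1 → e = e'
  edge_dom : ∀ u w, C.E u w → (C.N u).isSome ∧ (C.N w).isSome
  mono : ∀ u w, C.E u w → C.L u ⊆ C.L w
  origin : ∀ e ∈ C.events, ∃ v, (C.N v).isSome ∧ e ∈ C.L v ∧
    ∀ w, (C.N w).isSome → e ∈ C.L w → Relation.ReflTransGen C.E v w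
  head : ∀ r v, C.H r = some v → (C.N v).isSome

theorem Config.Coherent.mono_path {D : MRDT T R O} {C : Config T R O D.State}
    (hC : C.Coherent D) {u w : ℕ} (h : Relation.ReflTransGen C.E u w) : C.L u ⊆ C.L w := by
  induction h with
  | refl => exact Finset.Subset.refl _
  | tail _ h ih => exact ih.trans (hC.mono _ _ h)

/-- The event set of a lowest common ancestor is the intersection of the event sets. -/
theorem Config.Coherent.L_lca
    {D : MRDT T R O} {C : Config T R O D.State} (hC : C.Coherent D) {v₁ v₂ vt : ℕ}
    (hv₁ : (C.N v₁).isSome) (hv₂ : (C.N v₂).isSome)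
    (h : isLCA (fun u => (C.N u).isSome) C.E v₁ v₂ vt) : C.L vt = C.L v₁ ∩ C.L v₂ := by
  obtain ⟨_, ht₁, ht₂, hmax⟩ := h
  refine Finset.Subset.antisymm
    (Finset.subset_inter (hC.mono_path ht₁) (hC.mono_path ht₂)) fun e he => ?_
  obtain ⟨he₁, he₂⟩ := Finset.mem_inter.1 he
  obtain ⟨v, hv, hev, hdesc⟩ := hC.origin e ⟨v₁, hv₁, he₁⟩
  exact hC.mono_path (hmax v hv (hdesc v₁ hv₁ he₁) (hdesc v₂ hv₂ he₂)) hev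

theorem coherent_initConfig (D : MRDT T R O) (r0 : R) :
    (initConfig D r0).Coherent D where
  state v σ h := by
    by_cases hv : v = 0 <;> simp_all [initConfig, MRDT.applySeq]
  time e he := by simp [Config.events, initConfig] at he
  edge_dom u w h := h.elim
  mono u w h := h.elim
  origin e he := by simp [Config.events, initConfig] at he
  head r v h := by
    by_cases hr : r = r0 <;> simp_all [initConfig]

/-- Adding a fresh version `v` below existing versions preserves coherence, provided the stored
state is the replay of its event set and every new event has a fresh timestamp. -/
theorem Config.Coherent.extend {D : MRDT T R O} {C C' : Config T R O D.State}
    (hC : C.Coherent D) {P : ℕ → Prop} {v : ℕ} {σ : D.State} {r : R} {A : Finset (Event T R O)}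
    (hv : C.N v = none) (hP : ∀ u, P u → (C.N u).isSome)
    (hN : C'.N = Function.update C.N v (some σ)) (hH : C'.H = Function.update C.H r (some v))
    (hL : C'.L = Function.update C.L v A) (hE : C'.E = fun u w => C.E u w ∨ (P u ∧ w = v))
    (hσ : σ = D.applySeq A.toList D.init)
    (hPA : ∀ u, P u → C.L u ⊆ A)
    (hA : (∀ e ∈ A, ∃ u, P u ∧ e ∈ C.L u) ∨
      ∃ e₀ ∈ A, (∀ e ∈ C.events, e.1 ≠ e₀.1) ∧ ∀ e ∈ A, e = e₀ ∨ ∃ u, P u ∧ e ∈ C.L u) :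
    C'.Coherent D := by
  have hne : ∀ {u}, (C.N u).isSome → u ≠ v := by
    rintro u hu rfl
    simp [hv] at hu
  have hNold : ∀ {u}, u ≠ v → C'.N u = C.N u := fun h => by rw [hN, Function.update_of_ne h]
  have hLold : ∀ {u}, u ≠ v → C'.L u = C.L u := fun h => by rw [hL, Function.update_of_ne h]
  have hNv : C'.N v = some σ := by rw [hN, Function.update_self]
  have hLv : C'.L v = A := by rw [hL, Function.update_self]
  have hdom : ∀ {u}, (C.N u).isSome → (C'.N u).isSome := fun h => by rwa [hNold (hne h)]
  have hpath : ∀ {u w}, Relation.ReflTransGen C.E u w → Relation.ReflTransGen C'.E u w :=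
    fun {u w} h => Relation.ReflTransGen.mono (fun a b hab => by rw [hE]; exact Or.inl hab) u w h
  have hstep : ∀ {u}, P u → C'.E u v := fun h => by rw [hE]; exact Or.inr ⟨h, rfl⟩
  have hold : ∀ {e u}, P u → e ∈ C.L u → e ∈ C.events := fun h he => ⟨_, hP _ h, he⟩
  have hev : ∀ e ∈ C'.events, e ∈ C.events ∨ e ∈ A := by
    rintro e ⟨u, hu, heu⟩
    by_cases huv : u = v
    · subst huv
      exact Or.inr (hLv ▸ heu)
    · rw [hNold huv] at hu
      rw [hLold huv] at heu
      exact Or.inl ⟨u, hu, heu⟩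
  have hori : ∀ e ∈ C.events, (e ∈ A → ∃ u, P u ∧ e ∈ C.L u) →
      ∃ u, (C'.N u).isSome ∧ e ∈ C'.L u ∧
        ∀ w, (C'.N w).isSome → e ∈ C'.L w → Relation.ReflTransGen C'.E u w := by
    intro e he heA
    obtain ⟨u, hu, heu, hdesc⟩ := hC.origin e he
    refine ⟨u, hdom hu, by rwa [hLold (hne hu)], fun w hw hew => ?_⟩
    by_cases hwv : w = v
    · subst hwv
      obtain ⟨p, hp, hep⟩ := heA (hLv ▸ hew)
      exact (hpath (hdesc p (hP p hp) hep)).tail (hstep hp)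
    · rw [hNold hwv] at hw
      rw [hLold hwv] at hew
      exact hpath (hdesc w hw hew)
  have hboth : (∀ e ∈ C'.events, e ∈ C.events ∧ (e ∈ A → ∃ u, P u ∧ e ∈ C.L u)) ∨
      ∃ e₀ ∈ A, (∀ e ∈ C.events, e.1 ≠ e₀.1) ∧
        ∀ e ∈ C'.events, e = e₀ ∨ (e ∈ C.events ∧ (e ∈ A → ∃ u, P u ∧ e ∈ C.L u)) := by
    rcases hA with hA | ⟨e₀, he₀, hfresh, hA⟩
    · refine Or.inl fun e he => ⟨?_, hA e⟩
      rcases hev e he with h | h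
      · exact h
      · obtain ⟨u, hu, heu⟩ := hA e h
        exact hold hu heu
    · refine Or.inr ⟨e₀, he₀, hfresh, fun e he => ?_⟩
      by_cases hee : e = e₀
      · exact Or.inl hee
      · refine Or.inr ⟨?_, fun h => (hA e h).resolve_left hee⟩
        rcases hev e he with h | h
        · exact h
        · obtain ⟨u, hu, heu⟩ := (hA e h).resolve_left hee
          exact hold hu heu
  refine ⟨fun u τ hu => ?_, fun e he e' he' ht => ?_, fun u w h => ?_, fun u w h => ?_,
    fun e he => ?_, fun r' u h => ?_⟩
  · by_cases huv : u = v
    · subst huv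
      rw [hNv, Option.some_inj] at hu
      rw [← hu, hLv, hσ]
    · rw [hNold huv] at hu
      rw [hLold huv]
      exact hC.state u τ hu
  · rcases hboth with h | ⟨e₀, -, hfresh, h⟩
    · exact hC.time e (h e he).1 e' (h e' he').1 ht
    · rcases h e he with rfl | h₁ <;> rcases h e' he' with rfl | h₂
      · rfl
      · exact absurd ht.symm (hfresh e' h₂.1)
      · exact absurd ht (hfresh e h₁.1)
      · exact hC.time e h₁.1 e' h₂.1 ht
  · rw [hE] at h
    rcases h with h | ⟨h, rfl⟩
    · exact ⟨hdom (hC.edge_dom u w h).1, hdom (hC.edge_dom u w h).2⟩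
    · exact ⟨hdom (hP u h), by rw [hNv]; rfl⟩
  · rw [hE] at h
    rcases h with h | ⟨h, rfl⟩
    · rw [hLold (hne (hC.edge_dom u w h).1), hLold (hne (hC.edge_dom u w h).2)]
      exact hC.mono u w h
    · rw [hLold (hne (hP u h)), hLv]
      exact hPA u h
  · rcases hboth with h | ⟨e₀, he₀, hfresh, h⟩
    · exact hori e (h e he).1 (h e he).2
    · rcases h e he with rfl | h'
      · refine ⟨v, by rw [hNv]; rfl, by rwa [hLv], fun w hw hew => ?_⟩
        by_cases hwv : w = v
        · rw [hwv]
        · rw [hNold hwv] at hw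
          rw [hLold hwv] at hew
          exact absurd rfl (hfresh e ⟨w, hw, hew⟩)
      · exact hori e h'.1 h'.2
  · rw [hH] at h
    by_cases hr : r' = r
    · subst hr
      rw [Function.update_self, Option.some_inj] at h
      rw [← h, hNv]
      rfl
    · rw [Function.update_of_ne hr] at h
      exact hdom (hC.head r' u h)

/-- Merging the replays of two event sets over the replay of their intersection replays their
union. -/
theorem merge_replay {D : MRDT T R O} (h2 : BottomUp2OP D) (h1 : BottomUp1OP D)
    (h0 : BottomUp0OP D) (hidem : MergeIdempotence D) (hcomm : MergeCommutativity D)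
    (A B : Finset (Event T R O))
    (htime : ∀ e ∈ A ∪ B, ∀ e' ∈ A ∪ B, e.1 = e'.1 → e = e')
    (hc : ∀ e ∈ A ∪ B, ∀ e' ∈ A ∪ B, D.Commute e e') :
    D.merge (D.applySeq (A ∩ B).toList D.init) (D.applySeq A.toList D.init)
      (D.applySeq B.toList D.init) = D.applySeq (A ∪ B).toList D.init := by
  have hA : A.toList.Perm ((A \ B).toList ++ (A ∩ B).toList) := by
    rw [List.perm_ext_iff_of_nodup A.nodup_toList]
    · intro e
      simp
      tauto
    · refine List.Nodup.append (Finset.nodup_toList _) (Finset.nodup_toList _) fun e => ?_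
      simp
      tauto
  have hB : B.toList.Perm ((B \ A).toList ++ (A ∩ B).toList) := by
    rw [List.perm_ext_iff_of_nodup B.nodup_toList]
    · intro e
      simp
      tauto
    · refine List.Nodup.append (Finset.nodup_toList _) (Finset.nodup_toList _) fun e => ?_
      simp
      tauto
  have hAB : (A ∪ B).toList.Perm
      (((A \ B).toList ++ (B \ A).toList) ++ (A ∩ B).toList) := by
    rw [List.perm_ext_iff_of_nodup (Finset.nodup_toList _)]
    · intro e
      simp
      tauto
    · refine List.Nodup.append (List.Nodup.append (Finset.nodup_toList _)
        (Finset.nodup_toList _) fun e => ?_) (Finset.nodup_toList _) fun e => ?_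
      all_goals
        simp
        tauto
  rw [MRDT.applySeq_perm hA (by simp_all), MRDT.applySeq_perm hB (by simp_all),
    MRDT.applySeq_perm hAB (by simp_all), D.applySeq_append, D.applySeq_append,
    D.applySeq_append, merge_applySeq_same h0, merge_applySeq h2 h1 hidem hcomm]
  · intro e he e' he' ht
    simp only [Finset.mem_toList, Finset.mem_sdiff] at he he'
    have := htime e (by simp [he]) e' (by simp [he']) ht
    exact he.2 (this ▸ he'.1)
  · intro e he e' he'
    simp only [Finset.mem_toList, Finset.mem_sdiff] at he he'
    exact hc e (by simp [he]) e' (by simp [he'])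

theorem Config.Coherent.step {D : MRDT T R O} (hnc : RcNonComm D) (hcc : CondComm D)
    (h2 : BottomUp2OP D) (h1 : BottomUp1OP D) (h0 : BottomUp0OP D)
    (hidem : MergeIdempotence D) (hcomm : MergeCommutativity D) {C C' : Config T R O D.State}
    (hC : C.Coherent D) (h : Step D C C') : C'.Coherent D := by
  have hcomm_of_time : ∀ A : Finset (Event T R O),
      (∀ e ∈ A, ∀ e' ∈ A, e.1 = e'.1 → e = e') → ∀ e ∈ A, ∀ e' ∈ A, D.Commute e e' := by
    intro A hA e he e' he'
    by_cases ht : e.1 = e'.1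
    · rw [hA e he e' he' ht]
      exact fun _ => rfl
    · exact commute_of_time_ne hnc hcc h2 h1 h0 hidem hcomm ht
  cases h with
  | createBranch r r' vr v σ hr hσ hr' hv =>
    exact hC.extend (P := (· = vr)) hv (by rintro u rfl; simp [hσ]) rfl rfl rfl rfl
      (hC.state _ _ hσ) (by rintro u rfl; rfl) (Or.inl fun e he => ⟨vr, rfl, he⟩)
  | applyOp t r o vr v σ hr hσ hv ht =>
    have hsub : ∀ e ∈ C.L vr, e ∈ C.events := fun e he => ⟨vr, by simp [hσ], he⟩
    refine hC.extend (P := (· = vr)) hv (by rintro u rfl; simp [hσ]) rfl rfl rfl rfl ?_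
      (by rintro u rfl; exact Finset.subset_insert _ _)
      (Or.inr ⟨(t, r, o), Finset.mem_insert_self _ _, ht, fun e he =>
        (Finset.mem_insert.1 he).imp id fun h => ⟨vr, rfl, h⟩⟩)
    have hnew : (t, r, o) ∉ C.L vr := fun h => ht _ (hsub _ h) rfl
    have hperm : (insert (t, r, o) (C.L vr)).toList.Perm ((C.L vr).toList ++ [(t, r, o)]) :=
      (Finset.toList_insert hnew).trans (List.perm_append_singleton _ _).symm
    rw [MRDT.applySeq_perm hperm, D.applySeq_append, ← hC.state _ _ hσ]
    · rfl
    · simp only [Finset.mem_toList]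
      refine hcomm_of_time _ fun e he e' he' hte => ?_
      rcases Finset.mem_insert.1 he with rfl | he <;> rcases Finset.mem_insert.1 he' with rfl | he'
      · rfl
      · exact absurd hte.symm (ht _ (hsub _ he'))
      · exact absurd hte (ht _ (hsub _ he))
      · exact hC.time _ (hsub _ he) _ (hsub _ he') hte
  | mergeOp r1 r2 v1 v2 vt v σ1 σ2 σt hr1 hr2 hσ1 hσ2 hσt hlca hv =>
    have hv1 : (C.N v1).isSome := by simp [hσ1]
    have hv2 : (C.N v2).isSome := by simp [hσ2]
    have hsub : ∀ e ∈ C.L v1 ∪ C.L v2, e ∈ C.events := fun e he =>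
      (Finset.mem_union.1 he).elim (fun h => ⟨v1, hv1, h⟩) fun h => ⟨v2, hv2, h⟩
    have htime : ∀ e ∈ C.L v1 ∪ C.L v2, ∀ e' ∈ C.L v1 ∪ C.L v2, e.1 = e'.1 → e = e' :=
      fun e he e' he' => hC.time e (hsub e he) e' (hsub e' he')
    refine hC.extend (P := fun u => u = v1 ∨ u = v2) hv (by rintro u (rfl | rfl) <;> assumption)
      rfl rfl rfl rfl ?_ ?_ (Or.inl fun e he => ?_)
    · rw [hC.state _ _ hσ1, hC.state _ _ hσ2, hC.state _ _ hσt, hC.L_lca hv1 hv2 hlca]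
      exact merge_replay h2 h1 h0 hidem hcomm _ _ htime (hcomm_of_time _ htime)
    · rintro u (rfl | rfl)
      · exact Finset.subset_union_left
      · exact Finset.subset_union_right
    · rcases Finset.mem_union.1 he with h | h
      · exact ⟨v1, Or.inl rfl, h⟩
      · exact ⟨v2, Or.inr rfl, h⟩
  | queryOp => exact hC

theorem precedes_append {π ρ : List (Event T R O)} {e e' : Event T R O} (he : e ∈ π)
    (he' : e' ∈ ρ) : precedes (π ++ ρ) e e' := by
  obtain ⟨i, hi⟩ := List.mem_iff_getElem?.1 he
  obtain ⟨j, hj⟩ := List.mem_iff_getElem?.1 he'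
  have hlt : i < π.length := (List.getElem?_eq_some_iff.1 hi).1
  refine ⟨i, π.length + j, by omega, by rw [List.getElem?_append_left hlt, hi], ?_⟩
  rw [List.getElem?_append_right (by omega), Nat.add_sub_cancel_left, hj]

/-- Theorem 1: an MRDT satisfying rc-non-comm, cond-comm,
no-rc-chain, BottomUp-2-OP, BottomUp-1-OP, BottomUp-0-OP, MergeIdempotence and
MergeCommutativity is RA-linearizable. -/
theorem bottomUp_sound (T R O : Type) [DecidableEq T] [DecidableEq R] [DecidableEq O]
    (D : MRDT T R O)
    (hnc : RcNonComm D) (hcc : CondComm D) (hchain : NoRcChain D)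
    (h2 : BottomUp2OP D) (h1 : BottomUp1OP D) (h0 : BottomUp0OP D)
    (hidem : MergeIdempotence D) (hcomm : MergeCommutativity D) :
    ∀ C : Config T R O D.State, Reachable D C → RALinConfig D C := by
  classical
  rintro C ⟨r0, hreach⟩
  have hC : C.Coherent D := by
    induction hreach with
    | refl => exact coherent_initConfig D r0
    | tail _ hstep ih => exact ih.step hnc hcc h2 h1 h0 hidem hcomm hstep
  intro r vr hr
  obtain ⟨σ, hσ⟩ := Option.isSome_iff_exists.1 (hC.head r vr hr)
  have hcommute : ∀ e ∈ C.events, ∀ e' ∈ C.events, D.Commute e e' := by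
    intro e he e' he'
    by_cases ht : e.1 = e'.1
    · rw [hC.time e he e' he' ht]
      exact fun _ => rfl
    · exact commute_of_time_ne hnc hcc h2 h1 h0 hidem hcomm ht
  set source : Event T R O → Bool := fun e => decide (∃ o, D.rc e.2.2 o) with hsource
  have hperm : ((C.L vr).toList.filter source ++ (C.L vr).toList.filter (fun e => !source e)).Perm
      (C.L vr).toList := List.filter_append_perm _ _
  refine ⟨_, hperm.nodup_iff.2 (Finset.nodup_toList _), fun e => ?_, fun e e' he he' hlo => ?_, ?_⟩
  · rw [hperm.mem_iff, Finset.mem_toList]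
  · obtain ⟨hev, hev', ⟨-, hn⟩ | ⟨-, -, hrc, -⟩⟩ := hlo
    · exact absurd (hcommute e hev e' hev') hn
    · refine precedes_append ?_ ?_
      · simp only [List.mem_filter, Finset.mem_toList, hsource, decide_eq_true_eq]
        exact ⟨he, _, hrc⟩
      · simp only [List.mem_filter, Finset.mem_toList, hsource, Bool.not_eq_true',
          decide_eq_false_iff_not]
        exact ⟨he', fun ⟨o, ho⟩ => hchain ⟨_, _, o, hrc, ho⟩⟩
  · have hmem : ∀ e ∈ (C.L vr).toList, e ∈ C.events := fun e he =>
      ⟨vr, by simp [hσ], Finset.mem_toList.1 he⟩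
    rw [hσ, hC.state _ _ hσ, MRDT.applySeq_perm hperm.symm]
    exact fun e he e' he' => hcommute e (hmem e he) e' (hmem e' he')
end
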